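/- Let K be a field and let (V₀, V₁, f_V, g_V) and (W₀, W₁, f_W, g_W) be square-zero odd operators on super K-vector spaces (so g_V∘f_V = 0, f_V∘g_V = 0, g_W∘f_W = 0, f_W∘g_W = 0). Set P₀ := (V₀ ⊗ W₀) ⊕ (V₁ ⊗ W₁) and P₁ := (V₁ ⊗ W₀) ⊕ (V₀ ⊗ W₁), and define K-linear maps D₀ : P₀ → P₁ by D₀(v₀ ⊗ w₀) = (f_V v₀) ⊗ w₀ + v₀ ⊗ (f_W w₀) and D₀(v₁ ⊗ w₁) = (g_V v₁) ⊗ w₁ − v₁ ⊗ (g_W w₁), and D₁ : P₁ → P₀ by D₁(v₁ ⊗ w₀) = (g_V v₁) ⊗ w₀ − v₁ ⊗ (f_W w₀) and D₁(v₀ ⊗ w₁) = (f_V v₀) ⊗ w₁ + v₀ ⊗ (g_W w₁). Then D₁ ∘ D₀ = 0 and D₀ ∘ D₁ = 0, and there are K-linear isomorphisms ker D₀ ⧸ range D₁ ≅ (H₀(V) ⊗ H₀(W)) ⊕ (H₁(V) ⊗ H₁(W)) and ker D₁ ⧸ range D₀ ≅ (H₁(V) ⊗ H₀(W)) ⊕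 (H₀(V) ⊗ H₁(W)). (That is, the Duflo–Serganova functor is monoidal: (M ⊗ N)_x ≅ M_x ⊗ N_x as super vector spaces, where x acts on M ⊗ N by the super Leibniz rule x(m ⊗ n) = xm ⊗ n + (−1)^{|m|} m ⊗ xn.) -/

import Mathlib

open TensorProduct

/-- The even homology `ker f ⧸ range g` of a square-zero odd operator `(f, g)`. -/
abbrev OddOpHomology {K V₀ V₁ : Type*} [Field K]
    [AddCommGroup V₀] [AddCommGroup V₁] [Module K V₀] [Module K V₁]
    (f : V₀ →ₗ[K] V₁) (g : V₁ →ₗ[K] V₀) : Type _ :=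
  ↥(LinearMap.ker f) ⧸ (LinearMap.range g).comap (LinearMap.ker f).subtype

section OddContraction

variable {K V₀ V₁ W₀ W₁ H₀ H₁ G₀ G₁ : Type*} [Field K]
  [AddCommGroup V₀] [AddCommGroup V₁] [AddCommGroup W₀] [AddCommGroup W₁]
  [AddCommGroup H₀] [AddCommGroup H₁] [AddCommGroup G₀] [AddCommGroup G₁]
  [Module K V₀] [Module K V₁] [Module K W₀] [Module K W₁]
  [Module K H₀] [Module K H₁] [Module K G₀] [Module K G₁]

/-- A contraction of the odd operator `(f, g)` onto the pair `(H₀, H₁)` with zero operator: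
inclusions `i₀`, `i₁`, projections `p₀`, `p₁`, and a homotopy `(h, k)` from `i ∘ p` to the
identity. -/
structure OddContraction (f : V₀ →ₗ[K] V₁) (g : V₁ →ₗ[K] V₀)
    (H₀ H₁ : Type*) [AddCommGroup H₀] [AddCommGroup H₁] [Module K H₀] [Module K H₁] where
  i₀ : H₀ →ₗ[K] V₀
  i₁ : H₁ →ₗ[K] V₁
  p₀ : V₀ →ₗ[K] H₀
  p₁ : V₁ →ₗ[K] H₁
  h : V₀ →ₗ[K] V₁
  k : V₁ →ₗ[K] V₀
  f_i₀ : ∀ x, f (i₀ x) = 0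
  g_i₁ : ∀ x, g (i₁ x) = 0
  p₀_g : ∀ x, p₀ (g x) = 0
  p₁_f : ∀ x, p₁ (f x) = 0
  p₀_i₀ : ∀ x, p₀ (i₀ x) = x
  p₁_i₁ : ∀ x, p₁ (i₁ x) = x
  homotopy₀ : ∀ x, g (h x) = x - i₀ (p₀ x) - k (f x)
  homotopy₁ : ∀ x, f (k x) = x - i₁ (p₁ x) - h (g x)

namespace OddContraction

/-- Exchanging the parities. -/
def swap {f : V₀ →ₗ[K] V₁} {g : V₁ →ₗ[K] V₀} (c : OddContraction f g H₀ H₁) :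
    OddContraction g f H₁ H₀ where
  i₀ := c.i₁
  i₁ := c.i₀
  p₀ := c.p₁
  p₁ := c.p₀
  h := c.k
  k := c.h
  f_i₀ := c.g_i₁
  g_i₁ := c.f_i₀
  p₀_g := c.p₁_f
  p₁_f := c.p₀_g
  p₀_i₀ := c.p₁_i₁
  p₁_i₁ := c.p₀_i₀
  homotopy₀ := c.homotopy₁
  homotopy₁ := c.homotopy₀

/-- Changing the sign of the odd operator. -/
def neg {f : V₀ →ₗ[K] V₁} {g : V₁ →ₗ[K] V₀} (c : OddContraction f g H₀ H₁) :
    OddContraction (-f) (-g) H₀ H₁ where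
  i₀ := c.i₀
  i₁ := c.i₁
  p₀ := c.p₀
  p₁ := c.p₁
  h := -c.h
  k := -c.k
  f_i₀ x := by simp [c.f_i₀]
  g_i₁ x := by simp [c.g_i₁]
  p₀_g x := by simp [c.p₀_g]
  p₁_f x := by simp [c.p₁_f]
  p₀_i₀ := c.p₀_i₀
  p₁_i₁ := c.p₁_i₁
  homotopy₀ x := by simp [c.homotopy₀]
  homotopy₁ x := by simp [c.homotopy₁]

end OddContraction

theorem LinearMap.exists_comp_comp_eq_self (f : V₀ →ₗ[K] V₁) :
    ∃ k : V₁ →ₗ[K] V₀, ∀ x, f (k (f x)) = f x := by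
  obtain ⟨s, hs⟩ := f.rangeRestrict.exists_rightInverse_of_surjective f.range_rangeRestrict
  obtain ⟨k, hk⟩ := s.exists_extend
  refine ⟨k, fun x => ?_⟩
  have h₁ : k (f x) = s (f.rangeRestrict x) := LinearMap.congr_fun hk (f.rangeRestrict x)
  have h₂ := congrArg Subtype.val (LinearMap.congr_fun hs (f.rangeRestrict x))
  rw [h₁]
  exact h₂

theorem exists_homotopy (f : V₀ →ₗ[K] V₁) (g : V₁ →ₗ[K] V₀)
    (hgf : ∀ v, g (f v) = 0) (hfg : ∀ v, f (g v) = 0) :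
    ∃ (h : V₀ →ₗ[K] V₁) (k : V₁ →ₗ[K] V₀), (∀ x, f (k (f x)) = f x) ∧
      (∀ x, g (h (g x)) = g x) ∧ (∀ x, g (h (k x)) = 0) ∧ (∀ x, f (k (h x)) = 0) := by
  obtain ⟨k, hk⟩ := f.exists_comp_comp_eq_self
  obtain ⟨h, hh⟩ := g.exists_comp_comp_eq_self
  refine ⟨h - f ∘ₗ k ∘ₗ h, k - g ∘ₗ h ∘ₗ k, ?_, ?_, ?_, ?_⟩ <;> intro x <;>
    simp [hk, hh, hgf, hfg]

theorem OddOpHomology.exists_incl_proj (f : V₀ →ₗ[K] V₁) (g : V₁ →ₗ[K] V₀)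
    (hfg : ∀ v, f (g v) = 0)
    (h : V₀ →ₗ[K] V₁) (k : V₁ →ₗ[K] V₀) (hk : ∀ x, f (k (f x)) = f x)
    (hh : ∀ x, g (h (g x)) = g x) (hhk : ∀ x, g (h (k x)) = 0) :
    ∃ (i : OddOpHomology f g →ₗ[K] V₀) (p : V₀ →ₗ[K] OddOpHomology f g),
      (∀ x, f (i x) = 0) ∧ (∀ x, p (g x) = 0) ∧ (∀ x, p (i x) = x) ∧
      ∀ x, g (h x) = x - i (p x) - k (f x) := by
  let e : V₀ →ₗ[K] V₀ := LinearMap.id - g ∘ₗ h - k ∘ₗ f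
  have he : ∀ x, e x = x - g (h x) - k (f x) := fun _ => rfl
  have hfe : ∀ x, f (e x) = 0 := fun x => by simp [he, hfg, hk]
  have heg : ∀ x, e (g x) = 0 := fun x => by simp [he, hfg, hh]
  have hee : ∀ x, e (e x) = e x := fun x => by
    rw [he (e x), hfe]
    simp [he, hh, hhk]
  let q : V₀ →ₗ[K] OddOpHomology f g :=
    ((LinearMap.range g).comap (LinearMap.ker f).subtype).mkQ ∘ₗ
      e.codRestrict (LinearMap.ker f) hfe
  let j : OddOpHomology f g →ₗ[K] V₀ :=
    ((LinearMap.range g).comap (LinearMap.ker f).subtype).liftQ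
      (e ∘ₗ (LinearMap.ker f).subtype) (by
        rintro ⟨_, hx⟩ ⟨y, rfl⟩
        exact heg y)
  refine ⟨j, q, fun x => ?_, fun x => ?_, fun x => ?_, fun x => ?_⟩
  · obtain ⟨z, rfl⟩ := Submodule.Quotient.mk_surjective _ x
    exact hfe z
  · refine (Submodule.Quotient.mk_eq_zero _).2 ⟨0, ?_⟩
    rw [map_zero]
    exact (heg x).symm
  · obtain ⟨z, rfl⟩ := Submodule.Quotient.mk_surjective _ x
    refine (Submodule.Quotient.eq _).2 ⟨-h z, ?_⟩
    have hz : f z = 0 := z.2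
    change g (-h z) = e (e z) - z
    rw [hee, he z, hz]
    simp
  · have : j (q x) = e (e x) := rfl
    rw [this, hee, he]
    abel

theorem OddContraction.exists_homology (f : V₀ →ₗ[K] V₁) (g : V₁ →ₗ[K] V₀)
    (hgf : ∀ v, g (f v) = 0) (hfg : ∀ v, f (g v) = 0) :
    Nonempty (OddContraction f g (OddOpHomology f g) (OddOpHomology g f)) := by
  obtain ⟨h, k, hk, hh, hhk, hkh⟩ := exists_homotopy f g hgf hfg
  obtain ⟨i₀, p₀, a₀, b₀, c₀, d₀⟩ := OddOpHomology.exists_incl_proj f g hfg h k hk hh hhk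
  obtain ⟨i₁, p₁, a₁, b₁, c₁, d₁⟩ := OddOpHomology.exists_incl_proj g f hgf k h hh hk hkh
  exact ⟨⟨i₀, i₁, p₀, p₁, h, k, a₀, a₁, b₀, b₁, c₀, c₁, d₀, d₁⟩⟩

/-- A homotopy retract of the even part computes the even homology. -/
theorem OddOpHomology.nonempty_linearEquiv (f : V₀ →ₗ[K] V₁) (g : V₁ →ₗ[K] V₀)
    (i : H₀ →ₗ[K] V₀) (p : V₀ →ₗ[K] H₀) (h : V₀ →ₗ[K] V₁) (k : V₁ →ₗ[K] V₀)
    (hfi : ∀ x, f (i x) = 0) (hpg : ∀ x, p (g x) = 0) (hpi : ∀ x, p (i x) = x)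
    (hgh : ∀ x, g (h x) = x - i (p x) - k (f x)) :
    Nonempty (OddOpHomology f g ≃ₗ[K] H₀) := by
  let P : OddOpHomology f g →ₗ[K] H₀ :=
    ((LinearMap.range g).comap (LinearMap.ker f).subtype).liftQ
      (p ∘ₗ (LinearMap.ker f).subtype) (by
        rintro ⟨_, hx⟩ ⟨y, rfl⟩
        exact hpg y)
  let I : H₀ →ₗ[K] OddOpHomology f g :=
    ((LinearMap.range g).comap (LinearMap.ker f).subtype).mkQ ∘ₗ
      i.codRestrict (LinearMap.ker f) hfi
  refine ⟨LinearEquiv.ofLinearMap P I (LinearMap.ext hpi) (LinearMap.ext fun x => ?_)⟩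
  obtain ⟨z, rfl⟩ := Submodule.Quotient.mk_surjective _ x
  refine (Submodule.Quotient.eq _).2 ⟨-h z, ?_⟩
  have hz : f z = 0 := z.2
  change g (-h z) = i (p z) - z
  simp [hgh, hz]

/-- The super Leibniz rule on pure tensors determines the odd operator on all tensors. -/
theorem apply_eq_of_tmul
    {fV : V₀ →ₗ[K] V₁} {gV : V₁ →ₗ[K] V₀} {fW : W₀ →ₗ[K] W₁} {gW : W₁ →ₗ[K] W₀}
    (D : ((V₀ ⊗[K] W₀) × (V₁ ⊗[K] W₁)) →ₗ[K] ((V₁ ⊗[K] W₀) × (V₀ ⊗[K] W₁)))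
    (ha : ∀ v w, D (v ⊗ₜ[K] w, 0) = (fV v ⊗ₜ[K] w, v ⊗ₜ[K] fW w))
    (hb : ∀ v w, D (0, v ⊗ₜ[K] w) = (-(v ⊗ₜ[K] gW w), gV v ⊗ₜ[K] w))
    (x : V₀ ⊗[K] W₀) (y : V₁ ⊗[K] W₁) :
    D (x, y) = (fV.rTensor W₀ x - gW.lTensor V₁ y, fW.lTensor V₀ x + gV.rTensor W₁ y) := by
  have h : D = ((fV.rTensor W₀).prod (fW.lTensor V₀)).coprod
      ((-gW.lTensor V₁).prod (gV.rTensor W₁)) := by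
    ext v w <;> simp [ha, hb]
  simp [h, sub_eq_add_neg]

/-- The tensor product of two contractions computes the even homology of the tensor product
of the odd operators. -/
theorem OddContraction.nonempty_tensor_linearEquiv
    {fV : V₀ →ₗ[K] V₁} {gV : V₁ →ₗ[K] V₀} {fW : W₀ →ₗ[K] W₁} {gW : W₁ →ₗ[K] W₀}
    (c : OddContraction fV gV H₀ H₁) (d : OddContraction fW gW G₀ G₁)
    (D₀ : ((V₀ ⊗[K] W₀) × (V₁ ⊗[K] W₁)) →ₗ[K] ((V₁ ⊗[K] W₀) × (V₀ ⊗[K] W₁)))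
    (D₁ : ((V₁ ⊗[K] W₀) × (V₀ ⊗[K] W₁)) →ₗ[K] ((V₀ ⊗[K] W₀) × (V₁ ⊗[K] W₁)))
    (hD₀a : ∀ v w, D₀ (v ⊗ₜ[K] w, 0) = (fV v ⊗ₜ[K] w, v ⊗ₜ[K] fW w))
    (hD₀b : ∀ v w, D₀ (0, v ⊗ₜ[K] w) = (-(v ⊗ₜ[K] gW w), gV v ⊗ₜ[K] w))
    (hD₁a : ∀ v w, D₁ (v ⊗ₜ[K] w, 0) = (gV v ⊗ₜ[K] w, -(v ⊗ₜ[K] fW w)))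
    (hD₁b : ∀ v w, D₁ (0, v ⊗ₜ[K] w) = (v ⊗ₜ[K] gW w, fV v ⊗ₜ[K] w)) :
    Nonempty (OddOpHomology D₀ D₁ ≃ₗ[K] (H₀ ⊗[K] G₀) × (H₁ ⊗[K] G₁)) := by
  have hD₀ := apply_eq_of_tmul D₀ hD₀a hD₀b
  have hD₁ := apply_eq_of_tmul (fV := gV) (gV := fV) (fW := -fW) (gW := -gW) D₁
    (by simp [hD₁a, tmul_neg]) (by simp [hD₁b, tmul_neg])
  let T₀ : ((V₀ ⊗[K] W₀) × (V₁ ⊗[K] W₁)) →ₗ[K] ((V₁ ⊗[K] W₀) × (V₀ ⊗[K] W₁)) :=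
    LinearMap.coprod
      ((map c.h LinearMap.id).prod (map (c.i₀ ∘ₗ c.p₀) d.h))
      ((-map (c.i₁ ∘ₗ c.p₁) d.k).prod (map c.k LinearMap.id))
  let T₁ : ((V₁ ⊗[K] W₀) × (V₀ ⊗[K] W₁)) →ₗ[K] ((V₀ ⊗[K] W₀) × (V₁ ⊗[K] W₁)) :=
    LinearMap.coprod
      ((map c.k LinearMap.id).prod (-map (c.i₁ ∘ₗ c.p₁) d.h))
      ((map (c.i₀ ∘ₗ c.p₀) d.k).prod (map c.h LinearMap.id))
  let I := (map c.i₀ d.i₀).prodMap (map c.i₁ d.i₁)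
  let P := (map c.p₀ d.p₀).prodMap (map c.p₁ d.p₁)
  refine OddOpHomology.nonempty_linearEquiv D₀ D₁ I P T₀ T₁
    (LinearMap.congr_fun (f := D₀ ∘ₗ I) (g := 0) ?_)
    (LinearMap.congr_fun (f := P ∘ₗ D₁) (g := 0) ?_)
    (LinearMap.congr_fun (f := P ∘ₗ I) (g := LinearMap.id) ?_)
    (LinearMap.congr_fun (f := D₁ ∘ₗ T₀) (g := LinearMap.id - I ∘ₗ P - T₁ ∘ₗ D₀) ?_)
  · ext x y <;> simp [I, hD₀, c.f_i₀, c.g_i₁, d.f_i₀, d.g_i₁]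
  · ext x y <;> simp [P, hD₁, c.p₀_g, c.p₁_f, d.p₀_g, d.p₁_f]
  · ext x y <;> simp [I, P, c.p₀_i₀, c.p₁_i₁, d.p₀_i₀, d.p₁_i₁]
  · ext x y <;>
      simp [I, P, T₀, T₁, hD₀, hD₁, c.f_i₀, c.g_i₁, c.p₀_g, c.p₁_f,
        c.homotopy₀, c.homotopy₁, d.homotopy₀, d.homotopy₁, sub_tmul, tmul_sub] <;> abel

end OddContraction

/-- The Duflo–Serganova functor is monoidal: for square-zero odd operators on super
vector spaces `V = (V₀,V₁)` and `W = (W₀,W₁)`, the odd operator `x ⊗ 1 + σ ⊗ x` on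
`V ⊗ W` (with components `D₀, D₁` given by the super Leibniz rule) squares to zero
and its homology is `H(V) ⊗ H(W)`, i.e.
`ker D₀ ⧸ range D₁ ≅ (H₀(V) ⊗ H₀(W)) ⊕ (H₁(V) ⊗ H₁(W))` and
`ker D₁ ⧸ range D₀ ≅ (H₁(V) ⊗ H₀(W)) ⊕ (H₀(V) ⊗ H₁(W))`. -/
theorem DS_monoidal {K V₀ V₁ W₀ W₁ : Type*} [Field K]
    [AddCommGroup V₀] [AddCommGroup V₁] [AddCommGroup W₀] [AddCommGroup W₁]
    [Module K V₀] [Module K V₁] [Module K W₀] [Module K W₁]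
    (fV : V₀ →ₗ[K] V₁) (gV : V₁ →ₗ[K] V₀) (fW : W₀ →ₗ[K] W₁) (gW : W₁ →ₗ[K] W₀)
    (hV1 : ∀ v, gV (fV v) = 0) (hV2 : ∀ v, fV (gV v) = 0)
    (hW1 : ∀ w, gW (fW w) = 0) (hW2 : ∀ w, fW (gW w) = 0)
    (D₀ : ((V₀ ⊗[K] W₀) × (V₁ ⊗[K] W₁)) →ₗ[K] ((V₁ ⊗[K] W₀) × (V₀ ⊗[K] W₁)))
    (D₁ : ((V₁ ⊗[K] W₀) × (V₀ ⊗[K] W₁)) →ₗ[K] ((V₀ ⊗[K] W₀) × (V₁ ⊗[K] W₁)))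
    (hD₀a : ∀ (v : V₀) (w : W₀),
        D₀ (v ⊗ₜ[K] w, 0) = (fV v ⊗ₜ[K] w, v ⊗ₜ[K] fW w))
    (hD₀b : ∀ (v : V₁) (w : W₁),
        D₀ (0, v ⊗ₜ[K] w) = (-(v ⊗ₜ[K] gW w), gV v ⊗ₜ[K] w))
    (hD₁a : ∀ (v : V₁) (w : W₀),
        D₁ (v ⊗ₜ[K] w, 0) = (gV v ⊗ₜ[K] w, -(v ⊗ₜ[K] fW w)))
    (hD₁b : ∀ (v : V₀) (w : W₁),
        D₁ (0, v ⊗ₜ[K] w) = (v ⊗ₜ[K] gW w, fV v ⊗ₜ[K] w)) :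
    (∀ p, D₁ (D₀ p) = 0) ∧ (∀ p, D₀ (D₁ p) = 0) ∧
    Nonempty (OddOpHomology D₀ D₁ ≃ₗ[K]
      (OddOpHomology fV gV ⊗[K] OddOpHomology fW gW) ×
        (OddOpHomology gV fV ⊗[K] OddOpHomology gW fW)) ∧
    Nonempty (OddOpHomology D₁ D₀ ≃ₗ[K]
      (OddOpHomology gV fV ⊗[K] OddOpHomology fW gW) ×
        (OddOpHomology fV gV ⊗[K] OddOpHomology gW fW)) := by
  obtain ⟨c⟩ := OddContraction.exists_homology fV gV hV1 hV2
  obtain ⟨d⟩ := OddContraction.exists_homology fW gW hW1 hW2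
  have hD₀ := apply_eq_of_tmul D₀ hD₀a hD₀b
  have hD₁ := apply_eq_of_tmul (fV := gV) (gV := fV) (fW := -fW) (gW := -gW) D₁
    (by simp [hD₁a, tmul_neg]) (by simp [hD₁b, tmul_neg])
  refine ⟨LinearMap.congr_fun (f := D₁ ∘ₗ D₀) (g := 0) ?_,
    LinearMap.congr_fun (f := D₀ ∘ₗ D₁) (g := 0) ?_,
    c.nonempty_tensor_linearEquiv d D₀ D₁ hD₀a hD₀b hD₁a hD₁b,
    c.swap.nonempty_tensor_linearEquiv d.neg D₁ D₀ ?_ ?_ ?_ ?_⟩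
  · ext x y <;> simp [hD₀, hD₁, hV1, hV2, hW1, hW2]
  · ext x y <;> simp [hD₀, hD₁, hV1, hV2, hW1, hW2]
  · simp [hD₁a, tmul_neg]
  · simp [hD₁b, tmul_neg]
  · simp [hD₀a, tmul_neg]
  · simp [hD₀b, tmul_neg]
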